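/- The probability that the weighted Lasso estimator equals the zero vector is P(β̂_L = 0) = ∫_{−λ_p}^{λ_p} ⋯ ∫_{−λ_1}^{λ_1} φ_{(X'Xβ, σ²X'X)}(s) ds, i.e., the integral of the N(X'Xβ, σ²X'X) Lebesgue density over the box ∏_{j=1}^p [−λ_j, λ_j]. -/

import Mathlib

open MeasureTheory Matrix BigOperators

noncomputable section

/-- The weighted Lasso objective `L(b) = ‖y − Xb‖² + 2∑ λ_j |b_j|`. -/
def lassoL {n p : ℕ} (X : Matrix (Fin n) (Fin p) ℝ) (y : Fin n → ℝ)
    (lam : Fin p → ℝ) (b : Fin p → ℝ) : ℝ :=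
  (∑ i, (y i - X.mulVec b i) ^ 2) + 2 * ∑ j, lam j * |b j|

/-- The `N(μ, Σ)` Lebesgue density on `ℝ^k`:
`φ_{(μ,Σ)}(x) = (2π)^{−k/2}(det Σ)^{−1/2} exp(−(x−μ)'Σ⁻¹(x−μ)/2)`. -/
def gaussDensity {k : ℕ} (μ : Fin k → ℝ) (S : Matrix (Fin k) (Fin k) ℝ)
    (x : Fin k → ℝ) : ℝ :=
  (Real.sqrt ((2 * Real.pi) ^ k * S.det))⁻¹ *
    Real.exp (-(∑ i, ∑ j, (x i - μ i) * S⁻¹ i j * (x j - μ j)) / 2)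

open ProbabilityTheory

lemma mulVec_injective_of_rank_eq {n p : ℕ} (X : Matrix (Fin n) (Fin p) ℝ) (hX : X.rank = p) :
    Function.Injective X.mulVec := by
  have h := LinearMap.finrank_range_add_finrank_ker X.mulVecLin
  rw [Module.finrank_fin_fun] at h
  have hr : Module.finrank ℝ (LinearMap.range X.mulVecLin) = p := hX
  have hk : Module.finrank ℝ (LinearMap.ker X.mulVecLin) = 0 := by omega
  exact LinearMap.ker_eq_bot.1 (Submodule.finrank_eq_zero.1 hk)

lemma lassoL_eq_lassoL_zero_add {n p : ℕ} (X : Matrix (Fin n) (Fin p) ℝ) (y : Fin n → ℝ)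
    (lam b : Fin p → ℝ) :
    lassoL X y lam b = lassoL X y lam 0 +
      (∑ i, (X *ᵥ b) i ^ 2 + 2 * ∑ j, (lam j * |b j| - (Xᵀ *ᵥ y) j * b j)) := by
  have h : ∑ j, (Xᵀ *ᵥ y) j * b j = ∑ i, y i * (X *ᵥ b) i := by
    change (Xᵀ *ᵥ y) ⬝ᵥ b = y ⬝ᵥ (X *ᵥ b)
    rw [mulVec_transpose, dotProduct_mulVec]
  simp only [lassoL, mulVec_zero, Pi.zero_apply, sub_zero, abs_zero, mul_zero,
    Finset.sum_const_zero, add_zero, Finset.sum_sub_distrib, h, sub_sq, Finset.sum_add_distrib,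
    mul_assoc, ← Finset.mul_sum]
  ring

lemma abs_le_of_forall_mul_le {a c l : ℝ} (h : ∀ t : ℝ, c * t ≤ a * t ^ 2 + l * |t|) :
    |c| ≤ l := by
  have key : ∀ d : ℝ, (∀ t : ℝ, 0 < t → d * t ≤ a * t ^ 2 + l * t) → d ≤ l := by
    intro d hd
    by_contra! hlt
    have hpos : 0 < (d - l) / (2 * (|a| + 1)) := by
      have := abs_nonneg a
      exact div_pos (by linarith) (by linarith)
    set t := (d - l) / (2 * (|a| + 1)) with ht
    have h1 : d ≤ a * t + l := by
      have := hd t hpos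
      nlinarith
    have h2 : t * (2 * (|a| + 1)) = d - l := by
      rw [ht]; field_simp
    nlinarith [le_abs_self a, abs_nonneg a]
  refine abs_le'.2 ⟨key c fun t ht => ?_, key (-c) fun t ht => ?_⟩
  · simpa [abs_of_pos ht] using h t
  · simpa [abs_of_pos ht] using h (-t)

/-- The first order condition for `0` to be the Lasso solution. -/
lemma lasso_minimizer_eq_zero_iff {n p : ℕ} {X : Matrix (Fin n) (Fin p) ℝ}
    (hX : Function.Injective X.mulVec) {y : Fin n → ℝ} {lam b : Fin p → ℝ}
    (hb : ∀ b', lassoL X y lam b ≤ lassoL X y lam b') :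
    b = 0 ↔ Xᵀ *ᵥ y ∈ Set.univ.pi fun j => Set.Icc (-(lam j)) (lam j) := by
  simp only [Set.mem_univ_pi, Set.mem_Icc, ← abs_le]
  constructor
  · rintro rfl j
    refine abs_le_of_forall_mul_le (a := (∑ i, X i j ^ 2) / 2) fun t => ?_
    have h := hb (Pi.single j t)
    rw [lassoL_eq_lassoL_zero_add X y lam (Pi.single j t),
      Finset.sum_eq_single j (by intro k _ hk; simp [hk]) (by simp)] at h
    simp only [mulVec_single, Pi.single_eq_same] at h
    simp [mul_pow, ← Finset.sum_mul] at h
    linarith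
  · intro h
    have h0 := hb 0
    rw [lassoL_eq_lassoL_zero_add X y lam b] at h0
    have h1 : 0 ≤ ∑ j, (lam j * |b j| - (Xᵀ *ᵥ y) j * b j) := by
      refine Finset.sum_nonneg fun j _ => sub_nonneg.2 ?_
      calc (Xᵀ *ᵥ y) j * b j ≤ |(Xᵀ *ᵥ y) j * b j| := le_abs_self _
        _ = |(Xᵀ *ᵥ y) j| * |b j| := abs_mul _ _
        _ ≤ lam j * |b j| := by gcongr; exact h j
    have h2 : ∑ i, (X *ᵥ b) i ^ 2 = 0 :=
      le_antisymm (by linarith) (Finset.sum_nonneg fun i _ => sq_nonneg _)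
    apply hX
    rw [mulVec_zero]
    ext i
    have := (Finset.sum_eq_zero_iff_of_nonneg fun i _ => sq_nonneg _).1 h2 i (Finset.mem_univ i)
    simpa using this

lemma charFun_map_mulVec_pi_gaussianReal {n p : ℕ} (M : Matrix (Fin p) (Fin n) ℝ) (v : NNReal)
    (t : EuclideanSpace ℝ (Fin p)) :
    charFun (((Measure.pi fun _ : Fin n => gaussianReal 0 v).map M.mulVec).map (WithLp.toLp 2)) t =
      Complex.exp (-(v * ((t.ofLp ⬝ᵥ ((M * Mᵀ) *ᵥ t.ofLp) : ℝ) : ℂ) / 2)) := by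
  have hM : Measurable M.mulVec :=
    (Continuous.matrix_mulVec continuous_const continuous_id).measurable
  have h : charFun (((Measure.pi fun _ : Fin n => gaussianReal 0 v).map M.mulVec).map
      (WithLp.toLp 2)) t = charFun ((Measure.pi fun _ : Fin n => gaussianReal 0 v).map
      (WithLp.toLp 2)) (WithLp.toLp 2 (Mᵀ *ᵥ t.ofLp)) := by
    rw [charFun_apply, charFun_apply, integral_map (by fun_prop) (by fun_prop),
      integral_map (by fun_prop) (by fun_prop), integral_map (by fun_prop) (by fun_prop)]
    congr with x
    simp only [EuclideanSpace.inner_eq_star_dotProduct, star_trivial]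
    rw [dotProduct_mulVec, mulVec_transpose]
  rw [h, charFun_pi]
  simp only [charFun_gaussianReal, ← Complex.exp_sum]
  rw [← mulVec_mulVec, dotProduct_mulVec, ← mulVec_transpose]
  simp [dotProduct, Finset.mul_sum, Finset.sum_div, pow_two]

/-- The law of a linear image of a centred isotropic Gaussian vector depends only on `M * Mᵀ`. -/
lemma map_mulVec_pi_gaussianReal_congr {n m p : ℕ} {M : Matrix (Fin p) (Fin n) ℝ}
    {M' : Matrix (Fin p) (Fin m) ℝ} (h : M * Mᵀ = M' * M'ᵀ) (v : NNReal) :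
    (Measure.pi fun _ : Fin n => gaussianReal 0 v).map M.mulVec =
      (Measure.pi fun _ : Fin m => gaussianReal 0 v).map M'.mulVec := by
  have hM : Measurable M.mulVec :=
    (Continuous.matrix_mulVec continuous_const continuous_id).measurable
  have hM' : Measurable M'.mulVec :=
    (Continuous.matrix_mulVec continuous_const continuous_id).measurable
  have := Measure.isProbabilityMeasure_map
    (μ := Measure.pi fun _ : Fin n => gaussianReal 0 v) hM.aemeasurable
  have := Measure.isProbabilityMeasure_map
    (μ := Measure.pi fun _ : Fin m => gaussianReal 0 v) hM'.aemeasurable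
  apply (MeasurableEquiv.toLp 2 (Fin p → ℝ)).map_measurableEquiv_injective
  apply Measure.ext_of_charFun (E := EuclideanSpace ℝ (Fin p))
  ext t
  rw [MeasurableEquiv.coe_toLp, charFun_map_mulVec_pi_gaussianReal,
    charFun_map_mulVec_pi_gaussianReal, h]

lemma pi_gaussianReal_eq_withDensity {p : ℕ} {v : NNReal} (hv : v ≠ 0) :
    (Measure.pi fun _ : Fin p => gaussianReal 0 v) =
      volume.withDensity fun z => ENNReal.ofReal (∏ i, gaussianPDFReal 0 v (z i)) := by
  refine Measure.pi_eq fun s hs => ?_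
  have hint : Integrable (fun z : Fin p → ℝ => ∏ i, gaussianPDFReal 0 v (z i)) :=
    Integrable.fintype_prod fun _ => integrable_gaussianPDFReal 0 v
  rw [withDensity_apply _ (MeasurableSet.univ_pi hs),
    ← ofReal_integral_eq_lintegral_ofReal hint.restrict
      (ae_of_all _ fun z => Finset.prod_nonneg fun i _ => gaussianPDFReal_nonneg _ _ _),
    volume_pi, Measure.restrict_pi_pi, integral_fintype_prod_eq_prod
      (f := fun _ : Fin p => gaussianPDFReal 0 v), ENNReal.ofReal_prod_of_nonneg
      fun i _ => integral_nonneg fun _ => gaussianPDFReal_nonneg _ _ _]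
  simp_rw [gaussianReal_apply_eq_integral 0 hv]

lemma abs_det_mul_gaussDensity_affine {p : ℕ} {A : Matrix (Fin p) (Fin p) ℝ} (hA : A.det ≠ 0)
    {v : NNReal} (hv : v ≠ 0) (m z : Fin p → ℝ) :
    |A.det| * gaussDensity m ((v : ℝ) • (A * Aᵀ)) (m + A *ᵥ z) =
      ∏ i, gaussianPDFReal 0 v (z i) := by
  have hv' : (v : ℝ) ≠ 0 := by exact_mod_cast hv
  have hu : IsUnit A.det := isUnit_iff_ne_zero.2 hA
  have hinv : ((v : ℝ) • (A * Aᵀ))⁻¹ = (v : ℝ)⁻¹ • (A⁻¹ᵀ * A⁻¹) := by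
    apply inv_eq_right_inv
    rw [smul_mul_smul_comm, mul_inv_cancel₀ hv', one_smul, Matrix.mul_assoc,
      ← Matrix.mul_assoc Aᵀ, ← transpose_mul, nonsing_inv_mul _ hu, transpose_one,
      Matrix.one_mul, mul_nonsing_inv _ hu]
  have hquad : ∑ i, ∑ j, ((m + A *ᵥ z) i - m i) * ((v : ℝ) • (A * Aᵀ))⁻¹ i j *
      ((m + A *ᵥ z) j - m j) = (v : ℝ)⁻¹ * ∑ i, z i ^ 2 := by
    have : ∑ i, ∑ j, ((m + A *ᵥ z) i - m i) * ((v : ℝ) • (A * Aᵀ))⁻¹ i j *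
        ((m + A *ᵥ z) j - m j) = (A *ᵥ z) ⬝ᵥ (((v : ℝ) • (A * Aᵀ))⁻¹ *ᵥ (A *ᵥ z)) := by
      simp [dotProduct, mulVec, Finset.mul_sum, mul_assoc]
    rw [this, hinv, smul_mulVec, dotProduct_smul, ← mulVec_mulVec, dotProduct_mulVec,
      vecMul_transpose, mulVec_mulVec, nonsing_inv_mul _ hu, one_mulVec]
    simp [dotProduct, pow_two]
  have hdet : Real.sqrt ((2 * Real.pi) ^ p * ((v : ℝ) • (A * Aᵀ)).det) =
      Real.sqrt (2 * Real.pi * v) ^ p * |A.det| := by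
    rw [det_smul, det_mul, det_transpose, Fintype.card_fin, ← mul_assoc, ← mul_pow,
      Real.sqrt_mul (by positivity), Real.sqrt_mul_self_eq_abs]
    congr 1
    rw [Real.sqrt_eq_iff_eq_sq (by positivity) (by positivity), ← pow_mul, mul_comm p, pow_mul,
      Real.sq_sqrt (by positivity)]
  have hA' : |A.det| ≠ 0 := abs_ne_zero.2 hA
  simp only [gaussDensity, gaussianPDFReal]
  rw [hquad, hdet, Finset.prod_mul_distrib, ← Real.exp_sum]
  simp only [Finset.prod_const, Finset.card_univ, Fintype.card_fin, sub_zero]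
  rw [mul_inv, mul_comm _ |A.det|⁻¹, ← mul_assoc, ← mul_assoc, mul_inv_cancel₀ hA', one_mul,
    inv_pow]
  congr 2
  rw [Finset.mul_sum, ← Finset.sum_neg_distrib, Finset.sum_div]
  refine Finset.sum_congr rfl fun i _ => ?_
  field_simp

lemma map_affine_pi_gaussianReal_apply {p : ℕ} {A : Matrix (Fin p) (Fin p) ℝ} (hA : A.det ≠ 0)
    {v : NNReal} (hv : v ≠ 0) (m : Fin p → ℝ) {s : Set (Fin p → ℝ)} (hs : MeasurableSet s) :
    (Measure.pi fun _ : Fin p => gaussianReal 0 v) ((fun z => m + A *ᵥ z) ⁻¹' s) =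
      ENNReal.ofReal (∫ x in s, gaussDensity m ((v : ℝ) • (A * Aᵀ)) x) := by
  have hu : IsUnit A.det := isUnit_iff_ne_zero.2 hA
  have hcont : Continuous fun z : Fin p → ℝ => m + A *ᵥ z :=
    continuous_const.add (Continuous.matrix_mulVec continuous_const continuous_id)
  have hinj : Function.Injective fun z : Fin p → ℝ => m + A *ᵥ z :=
    (add_right_injective m).comp (mulVec_injective_of_isUnit ((isUnit_iff_isUnit_det A).2 hu))
  have hsurj : Function.Surjective fun z : Fin p → ℝ => m + A *ᵥ z := fun x =>
    ⟨A⁻¹ *ᵥ (x - m), by simp [mulVec_mulVec, mul_nonsing_inv _ hu]⟩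
  have hmeas := hcont.measurable hs
  have hder : ∀ z ∈ (fun z => m + A *ᵥ z) ⁻¹' s, HasFDerivWithinAt (fun z => m + A *ᵥ z)
      (LinearMap.toContinuousLinearMap (toLin' A)) ((fun z => m + A *ᵥ z) ⁻¹' s) z := fun z _ =>
    ((LinearMap.toContinuousLinearMap (toLin' A)).hasFDerivAt.const_add m).hasFDerivWithinAt
  have hcov := integral_image_eq_integral_abs_det_fderiv_smul volume hmeas hder hinj.injOn
    (gaussDensity m ((v : ℝ) • (A * Aᵀ)))
  have hint : Integrable (fun z : Fin p → ℝ => ∏ i, gaussianPDFReal 0 v (z i)) :=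
    Integrable.fintype_prod fun _ => integrable_gaussianPDFReal 0 v
  rw [Set.image_preimage_eq _ hsurj] at hcov
  rw [hcov, pi_gaussianReal_eq_withDensity hv, withDensity_apply _ hmeas,
    ← ofReal_integral_eq_lintegral_ofReal hint.restrict
      (ae_of_all _ fun z => Finset.prod_nonneg fun i _ => gaussianPDFReal_nonneg _ _ _)]
  simp only [smul_eq_mul, ContinuousLinearMap.det, LinearMap.coe_toContinuousLinearMap,
    LinearMap.det_toLin', abs_det_mul_gaussDensity_affine hA hv]

open scoped MatrixOrder in
lemma exists_mul_transpose_eq {n p : ℕ} (X : Matrix (Fin n) (Fin p) ℝ) :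
    ∃ A : Matrix (Fin p) (Fin p) ℝ, Xᵀ * X = A * Aᵀ := by
  have h : (Xᵀ * X).PosSemidef := by
    simpa [conjTranspose_eq_transpose_of_trivial] using posSemidef_conjTranspose_mul_self X
  obtain ⟨B, hB⟩ := CStarAlgebra.nonneg_iff_eq_star_mul_self.mp h.nonneg
  refine ⟨Bᵀ, ?_⟩
  rw [hB, star_eq_conjTranspose, conjTranspose_eq_transpose_of_trivial, transpose_transpose]

/-- `P(β̂_L = 0)` equals the integral of the `N(X'Xβ, σ²X'X)`
density over the box `∏_j [−λ_j, λ_j]`. -/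
theorem prob_lasso_all_zero
    {Ω : Type*} [MeasurableSpace Ω] (P : Measure Ω) [IsProbabilityMeasure P]
    {n p : ℕ} (X : Matrix (Fin n) (Fin p) ℝ) (hX : X.rank = p)
    (β : Fin p → ℝ) (σ : ℝ) (hσ : 0 < σ)
    (ε : Ω → Fin n → ℝ)
    (hε : Measure.map ε P =
      Measure.pi fun _ : Fin n => ProbabilityTheory.gaussianReal 0 ⟨σ ^ 2, sq_nonneg σ⟩)
    (lam : Fin p → ℝ) (hlam : ∀ j, 0 ≤ lam j)
    (βL : Ω → Fin p → ℝ)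
    (hβL : ∀ ω, ∀ b : Fin p → ℝ,
      lassoL X (X.mulVec β + ε ω) lam (βL ω) ≤ lassoL X (X.mulVec β + ε ω) lam b) :
    P {ω | βL ω = 0}
    = ENNReal.ofReal
        (∫ s in Set.univ.pi (fun j : Fin p => Set.Icc (-(lam j)) (lam j)),
          gaussDensity ((Xᵀ * X).mulVec β) (σ ^ 2 • (Xᵀ * X)) s) := by
  have hinj := mulVec_injective_of_rank_eq X hX
  set v : NNReal := ⟨σ ^ 2, sq_nonneg σ⟩ with hvdef
  have hvσ : (v : ℝ) = σ ^ 2 := rfl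
  have hv : v ≠ 0 := by
    rw [← NNReal.coe_ne_zero, hvσ]
    positivity
  obtain ⟨A, hA⟩ := exists_mul_transpose_eq X
  have hdet : A.det ≠ 0 := by
    have hpos : (Xᵀ * X).PosDef := by
      simpa [conjTranspose_eq_transpose_of_trivial] using PosDef.conjTranspose_mul_self X hinj
    intro h0
    simpa [hA, h0] using hpos.det_pos
  have hεm : AEMeasurable ε P := by
    apply AEMeasurable.of_map_ne_zero
    rw [hε]
    exact IsProbabilityMeasure.ne_zero _
  set s := Set.univ.pi fun j : Fin p => Set.Icc (-(lam j)) (lam j)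
  have hs : MeasurableSet s := MeasurableSet.univ_pi fun _ => measurableSet_Icc
  set m := (Xᵀ * X) *ᵥ β
  have hmeas {k : ℕ} (M : Matrix (Fin p) (Fin k) ℝ) : Measurable M.mulVec :=
    (Continuous.matrix_mulVec continuous_const continuous_id).measurable
  have hs' : MeasurableSet ((fun x => m + x) ⁻¹' s) := measurable_const_add m hs
  have hset : {ω | βL ω = 0} = ε ⁻¹' (Xᵀ.mulVec ⁻¹' ((fun x => m + x) ⁻¹' s)) := by
    ext ω
    rw [Set.mem_ofPred_eq, lasso_minimizer_eq_zero_iff hinj (hβL ω), mulVec_add, mulVec_mulVec]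
    rfl
  rw [hset, ← Measure.map_apply_of_aemeasurable hεm (hmeas _ hs'), hε,
    ← Measure.map_apply (hmeas _) hs',
    map_mulVec_pi_gaussianReal_congr (M' := A) (by rw [transpose_transpose, hA]) v,
    Measure.map_apply (hmeas _) hs', hA, ← hvσ, ← map_affine_pi_gaussianReal_apply hdet hv m hs]
  rfl

end
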